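/- Let K, L ∈ ℕ with L > K, let α ∈ 𝒞_{K,L} with associated sequence (n_k), and let f(x) = -log x - log(1-x) + g(x) with g ∈ C³(𝕋), g > 0. Set x_k = 1/(2q_{n_k}) and c_k = S_{q_{n_k}}(f)(x_k). If P is a probability measure on ℝ that is a weak limit of (a subsequence of) the pushforward measures (S_{K·q_{n_k}}(f) − K·c_k)_*(Leb), then P has exponential decay: there exist constants C̄, c̄ > 0 such that P({t ∈ ℝ : |t| ≥ s}) ≤ C̄·e^{−c̄·s} for every s > 0. -/

import Mathlib

open MeasureTheory Filter Topology

noncomputable section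

/-- Iterates of the Gauss map applied to the fractional part of `α`. -/
def gaussIter (α : ℝ) (n : ℕ) : ℝ := (fun x : ℝ => Int.fract x⁻¹)^[n] (Int.fract α)

/-- The `n`-th partial quotient `a_n` of the continued fraction expansion of `α`
(for `n ≥ 1`). -/
def cfA (α : ℝ) (n : ℕ) : ℕ := ⌊(gaussIter α (n - 1))⁻¹⌋₊

/-- The denominators `q_n` of the convergents of the continued fraction of `α`:
`q₀ = 1`, `q₁ = a₁`, `q_{n+1} = a_{n+1} q_n + q_{n-1}`. -/
def cfQ (α : ℝ) : ℕ → ℕ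
  | 0 => 1
  | 1 => cfA α 1
  | n + 2 => cfA α (n + 2) * cfQ α (n + 1) + cfQ α n

/-- Birkhoff sums over the rotation by `α`: `S_n(φ)(x) = ∑_{i<n} φ(x + iα)`. -/
def birkhoffRot (α : ℝ) (φ : ℝ → ℝ) (n : ℕ) (x : ℝ) : ℝ :=
  ∑ i ∈ Finset.range n, φ (x + i * α)

/-- Distance to the nearest integer, `‖x‖ = min(x mod 1, 1 - x mod 1)`. -/
def distNearestInt (x : ℝ) : ℝ := min (Int.fract x) (1 - Int.fract x)

/-- `h(x) = -log x - log(1-x)`, read on the circle. -/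
def symLog (x : ℝ) : ℝ := -Real.log (Int.fract x) - Real.log (1 - Int.fract x)

/-- The roof `f(x) = -log x - log(1-x) + g(x)`, read on the circle. -/
def symLogRoof (g : ℝ → ℝ) (x : ℝ) : ℝ := symLog x + g x

/-- The set `A_k(b) = {x ∈ 𝕋 : |S_q(f)(x) - c_k| ≥ b}` where `q = q_{n_k}` and
`c_k = S_q(f)(x_k)` with `x_k = 1/(2q)` (here `𝕋` is represented by `[0,1)`). -/
def AkSet (α : ℝ) (g : ℝ → ℝ) (q : ℕ) (b : ℝ) : Set ℝ :=
  {x | x ∈ Set.Ico (0 : ℝ) 1 ∧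
    b ≤ |birkhoffRot α (symLogRoof g) q x
          - birkhoffRot α (symLogRoof g) q (1 / (2 * (q : ℝ)))|}


theorem gaussIter_irrational {α : ℝ} (hirr : Irrational α) (n : ℕ) :
    Irrational (gaussIter α n) := by
  have hfract : ∀ x : ℝ, Irrational x → Irrational (Int.fract x) := fun x hx => by
    rw [← Int.self_sub_floor]
    exact hx.sub_intCast _
  induction n with
  | zero => exact hfract _ hirr
  | succ n ih =>
    rw [gaussIter, Function.iterate_succ_apply']
    exact hfract _ (irrational_inv_iff.mpr ih)

theorem gaussIter_mem_Ioo {α : ℝ} (hirr : Irrational α) (n : ℕ) :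
    gaussIter α n ∈ Set.Ioo (0 : ℝ) 1 := by
  have h0 : 0 ≤ gaussIter α n ∧ gaussIter α n < 1 := by
    cases n with
    | zero => exact ⟨Int.fract_nonneg _, Int.fract_lt_one _⟩
    | succ n =>
      rw [gaussIter, Function.iterate_succ_apply']
      exact ⟨Int.fract_nonneg _, Int.fract_lt_one _⟩
  exact ⟨lt_of_le_of_ne h0.1 (gaussIter_irrational hirr n).ne_zero.symm, h0.2⟩

theorem inv_gaussIter {α : ℝ} (hirr : Irrational α) (n : ℕ) :
    (gaussIter α n)⁻¹ = cfA α (n + 1) + gaussIter α (n + 1) := by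
  have hpos : 0 ≤ (gaussIter α n)⁻¹ := inv_nonneg.mpr (gaussIter_mem_Ioo hirr n).1.le
  have hstep : gaussIter α (n + 1) = Int.fract (gaussIter α n)⁻¹ := by
    rw [gaussIter, Function.iterate_succ_apply']; rfl
  rw [hstep, cfA, Nat.add_sub_cancel, natCast_floor_eq_intCast_floor hpos, Int.floor_add_fract]

theorem one_le_cfA {α : ℝ} (hirr : Irrational α) (n : ℕ) : 1 ≤ cfA α (n + 1) := by
  have h := gaussIter_mem_Ioo hirr n
  rw [cfA, Nat.add_sub_cancel, Nat.one_le_floor_iff]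
  exact (one_le_inv₀ h.1).mpr h.2.le

theorem one_le_cfQ {α : ℝ} (hirr : Irrational α) (n : ℕ) : 1 ≤ cfQ α n := by
  induction n using Nat.strong_induction_on with
  | _ n ih =>
    match n with
    | 0 => exact le_rfl
    | 1 => exact one_le_cfA hirr 0
    | n + 2 =>
      rw [cfQ]
      exact (ih n (by omega)).trans (Nat.le_add_left _ _)

/-- The representation of `α` by two consecutive convergents and a tail of its expansion. -/
theorem exists_convergent_pair {α : ℝ} (hirr : Irrational α) (hα : α ∈ Set.Ioo (0 : ℝ) 1) (n : ℕ) :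
    ∃ p p' : ℤ, (p' * cfQ α n - p * cfQ α (n + 1) = 1 ∨ p' * cfQ α n - p * cfQ α (n + 1) = -1) ∧
      α * (cfQ α (n + 1) + cfQ α n * gaussIter α (n + 1)) = p' + p * gaussIter α (n + 1) := by
  induction n with
  | zero =>
    refine ⟨0, 1, Or.inl (by simp [cfQ]), ?_⟩
    have h0 : gaussIter α 0 = α := Int.fract_eq_self.mpr ⟨hα.1.le, hα.2⟩
    have h := inv_gaussIter hirr 0
    rw [h0] at h
    simp only [cfQ, zero_add] at h ⊢
    rw [Nat.cast_one, one_mul, ← h, mul_inv_cancel₀ hα.1.ne']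
    simp
  | succ n ih =>
    obtain ⟨p, p', hdet, h⟩ := ih
    refine ⟨p', cfA α (n + 2) * p' + p, ?_, ?_⟩
    · rw [cfQ]
      push_cast
      rcases hdet with hdet | hdet
      · right; linear_combination -hdet
      · left; linear_combination -hdet
    · have ht := (gaussIter_mem_Ioo hirr (n + 1)).1
      have hinv := inv_gaussIter hirr (n + 1)
      have hmul : gaussIter α (n + 1) * (cfA α (n + 2) + gaussIter α (n + 2)) = 1 := by
        rw [← hinv, mul_inv_cancel₀ ht.ne']
      rw [cfQ]
      push_cast
      linear_combination (cfA α (n + 2) + gaussIter α (n + 2)) * h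
        + (p - α * cfQ α n) * hmul

theorem exists_isCoprime_abs_sub_le {α : ℝ} (hirr : Irrational α) (hα : α ∈ Set.Ioo (0 : ℝ) 1)
    (n : ℕ) : ∃ p : ℤ, IsCoprime p (cfQ α n : ℤ) ∧
      |α - p / cfQ α n| < 1 / (cfQ α n : ℝ) ^ 2 := by
  cases n with
  | zero =>
    refine ⟨0, by simp [cfQ, isCoprime_one_right], ?_⟩
    simpa [cfQ, abs_of_pos hα.1] using hα.2
  | succ n =>
    obtain ⟨p, p', hdet, h⟩ := exists_convergent_pair hirr hα n
    have hq : (1 : ℝ) ≤ cfQ α n := by exact_mod_cast one_le_cfQ hirr n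
    have hq' : (1 : ℝ) ≤ cfQ α (n + 1) := by exact_mod_cast one_le_cfQ hirr (n + 1)
    obtain ⟨ht0, ht1⟩ := gaussIter_mem_Ioo hirr (n + 1)
    refine ⟨p', ?_, ?_⟩
    · rcases hdet with hdet | hdet
      · exact ⟨cfQ α n, -p, by linear_combination hdet⟩
      · exact ⟨-cfQ α n, p, by linear_combination -hdet⟩
    · have hdetR : |(p' : ℝ) * cfQ α n - p * cfQ α (n + 1)| = 1 := by
        rcases hdet with hdet | hdet
        · have : (p' : ℝ) * cfQ α n - p * cfQ α (n + 1) = 1 := by exact_mod_cast hdet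
          rw [this, abs_one]
        · have : (p' : ℝ) * cfQ α n - p * cfQ α (n + 1) = -1 := by exact_mod_cast hdet
          rw [this, abs_neg, abs_one]
      set Q : ℝ := (↑(cfQ α (n + 1)) : ℝ)
      set R : ℝ := (↑(cfQ α n) : ℝ)
      set t := gaussIter α (n + 1)
      have hD : 0 < Q + R * t := by positivity
      have heq : (α - p' / Q) * (Q * (Q + R * t)) = -(t * (p' * R - p * Q)) := by
        field_simp
        linear_combination Q * h
      have habs : |α - p' / Q| * (Q * (Q + R * t)) = t := by
        rw [← abs_of_pos (by positivity : 0 < Q * (Q + R * t)), ← abs_mul, heq, abs_neg, abs_mul,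
          hdetR, mul_one, abs_of_pos ht0]
      rw [lt_div_iff₀ (by positivity)]
      have hRt : 0 < R * t := by positivity
      calc |α - p' / Q| * Q ^ 2 ≤ |α - p' / Q| * (Q * (Q + R * t)) := by
            gcongr; nlinarith
        _ < 1 := habs.trans_lt ht1

theorem sum_range_rational_rotation {ψ : ℝ → ℝ} (hψ : Function.Periodic ψ 1) {p : ℤ} {q : ℕ}
    (hq : 0 < q) (hpq : IsCoprime p (q : ℤ)) (x : ℝ) :
    ∑ j ∈ Finset.range q, ψ (x + j * (p / q)) =
      ∑ k ∈ Finset.range q, ψ ((Int.fract (q * x) + k) / q) := by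
  have hqz : (0 : ℤ) < q := by exact_mod_cast hq
  have hq0 : (q : ℝ) ≠ 0 := by positivity
  set r : ℕ → ℕ := fun j => ((⌊q * x⌋ + j * p) % q).toNat with hr
  have hrz : ∀ j, (r j : ℤ) = (⌊q * x⌋ + j * p) % q := fun j =>
    Int.toNat_of_nonneg (Int.emod_nonneg _ hqz.ne')
  have hmaps : Set.MapsTo r (Finset.range q) (Finset.range q) := fun j _ => by
    have := Int.emod_lt_of_pos (⌊q * x⌋ + j * p) hqz
    rw [← hrz] at this
    simpa using this
  have hinj : Set.InjOn r (Finset.range q) := fun i hi j hj hij => by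
    have h1 : (⌊q * x⌋ + i * p) ≡ (⌊q * x⌋ + j * p) [ZMOD q] := by
      rw [Int.ModEq, ← hrz, ← hrz, hij]
    have h2 : (q : ℤ) ∣ (j - i : ℤ) * p := by
      have := h1.dvd
      rwa [show (⌊q * x⌋ + j * p) - (⌊q * x⌋ + i * p) = (j - i : ℤ) * p by ring] at this
    have h3 : (q : ℤ) ∣ j - i := hpq.symm.dvd_of_dvd_mul_right h2
    have h4 : (i : ℤ) % q = j % q := (Int.modEq_iff_dvd.mpr h3 : _)
    simp only [Finset.coe_range, Set.mem_Iio] at hi hj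
    rw [Int.emod_eq_of_lt (by positivity) (by exact_mod_cast hi),
      Int.emod_eq_of_lt (by positivity) (by exact_mod_cast hj)] at h4
    exact_mod_cast h4
  refine Finset.sum_nbij r hmaps hinj
    (Finset.surjOn_of_injOn_of_card_le r hmaps hinj le_rfl) fun j _ => ?_
  have hdiv : ((r j : ℝ)) + q * (((⌊q * x⌋ + j * p) / q : ℤ) : ℝ) = ⌊q * x⌋ + j * p := by
    have := Int.emod_add_mul_ediv (⌊q * x⌋ + j * p) q
    rw [← hrz] at this
    exact_mod_cast this
  rw [← hψ.int_mul ((⌊q * x⌋ + j * p) / q) ((Int.fract (q * x) + r j) / q)]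
  congr 1
  have hfl := Int.floor_add_fract (q * x)
  generalize (⌊q * x⌋ + j * p) / (q : ℤ) = d at hdiv ⊢
  generalize Int.fract (q * x) = u, (⌊q * x⌋ : ℝ) = m at hfl hdiv ⊢
  field_simp
  linear_combination -hdiv - hfl

theorem abs_orbit_sub_le {α : ℝ} {p : ℤ} {q : ℕ} (hq : 0 < q)
    (hα : |α - p / q| < 1 / (q : ℝ) ^ 2) {j : ℕ} (hj : j < q) (x : ℝ) :
    |(x + j * α) - (x + j * (p / q))| < 1 / q := by
  have hq' : (0 : ℝ) < q := by exact_mod_cast hq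
  have hj' : (j : ℝ) < q := by exact_mod_cast hj
  rw [show (x + j * α) - (x + j * (p / q)) = j * (α - p / q) by ring, abs_mul, Nat.abs_cast]
  calc (j : ℝ) * |α - p / q| ≤ q * |α - p / q| := by gcongr
    _ < q * (1 / (q : ℝ) ^ 2) := by gcongr
    _ = 1 / q := by field_simp

/-- The **Denjoy–Koksma** bound for Lipschitz functions. -/
theorem abs_birkhoffRot_sub_le_of_lipschitz {α : ℝ} {p : ℤ} {q : ℕ} (hq : 0 < q)
    (hpq : IsCoprime p (q : ℤ)) (hα : |α - p / q| < 1 / (q : ℝ) ^ 2) {h : ℝ → ℝ} {M : ℝ}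
    (hper : Function.Periodic h 1) (hM : 0 ≤ M) (hlip : ∀ x y, |h x - h y| ≤ M * |x - y|) (x : ℝ) :
    |birkhoffRot α h q x - ∑ k ∈ Finset.range q, h (k / q)| ≤ 2 * M := by
  have hq' : (0 : ℝ) < q := by exact_mod_cast hq
  have hsum : ∀ u v : ℕ → ℝ, (∀ j < q, |u j - v j| ≤ 1 / q) →
      |∑ j ∈ Finset.range q, h (u j) - ∑ j ∈ Finset.range q, h (v j)| ≤ M := fun u v huv => by
    rw [← Finset.sum_sub_distrib]
    calc _ ≤ ∑ j ∈ Finset.range q, |h (u j) - h (v j)| := Finset.abs_sum_le_sum_abs _ _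
      _ ≤ ∑ j ∈ Finset.range q, M * (1 / q) := Finset.sum_le_sum fun j hj =>
          (hlip _ _).trans (by gcongr; exact huv j (Finset.mem_range.mp hj))
      _ = M := by rw [Finset.sum_const, Finset.card_range, nsmul_eq_mul]; field_simp
  have h1 := hsum (fun j => x + j * α) (fun j => x + j * (p / q))
    fun j hj => (abs_orbit_sub_le hq hα hj x).le
  have h2 := hsum (fun k => (Int.fract (q * x) + k) / q) (fun k => k / q) fun k _ => by
    rw [← sub_div, add_sub_cancel_right, abs_div, Nat.abs_cast, abs_of_nonneg (Int.fract_nonneg _)]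
    gcongr
    exact (Int.fract_lt_one _).le
  rw [← sum_range_rational_rotation hper hq hpq] at h2
  have := abs_sub_le (birkhoffRot α h q x) (∑ j ∈ Finset.range q, h (x + j * (p / q)))
    (∑ k ∈ Finset.range q, h (k / q))
  simp only [birkhoffRot] at this ⊢
  linarith

theorem abs_fract_sub_fract_le {y z δ : ℝ} (h : |y - z| ≤ δ) :
    |Int.fract y - Int.fract z| ≤ δ + (if Int.fract z < δ then 1 else 0)
      + (if 1 - δ ≤ Int.fract z then 1 else 0) := by
  have hy := Int.fract_nonneg y
  have hy' := Int.fract_lt_one y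
  have hz := Int.fract_nonneg z
  have hz' := Int.fract_lt_one z
  have hfy := Int.floor_add_fract y
  have hfz := Int.floor_add_fract z
  rw [abs_le] at h
  rcases lt_trichotomy ⌊y⌋ ⌊z⌋ with hlt | heq | hgt
  · have : (⌊y⌋ : ℝ) + 1 ≤ ⌊z⌋ := by exact_mod_cast hlt
    rw [abs_le]
    split_ifs <;> constructor <;> linarith
  · rw [heq] at hfy
    rw [abs_le]
    split_ifs <;> constructor <;> linarith
  · have : (⌊z⌋ : ℝ) + 1 ≤ ⌊y⌋ := by exact_mod_cast hgt
    rw [abs_le]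
    split_ifs <;> constructor <;> linarith

/-- The **Denjoy–Koksma** bound for the sawtooth function. -/
theorem abs_birkhoffRot_sawtooth_le {α : ℝ} {p : ℤ} {q : ℕ} (hq : 0 < q)
    (hpq : IsCoprime p (q : ℤ)) (hα : |α - p / q| < 1 / (q : ℝ) ^ 2) (x : ℝ) :
    |birkhoffRot α (fun y => Int.fract y - 1 / 2) q x| ≤ 4 := by
  have hq' : (0 : ℝ) < q := by exact_mod_cast hq
  have hper : Function.Periodic (Int.fract : ℝ → ℝ) 1 := Int.fract_add_one
  set u := Int.fract (q * x)
  have hu0 : 0 ≤ u := Int.fract_nonneg _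
  have hu1 : u < 1 := Int.fract_lt_one _
  have hfr : ∀ k ∈ Finset.range q, Int.fract ((u + k) / q) = (u + k) / q := fun k hk => by
    have hk' : (k : ℝ) + 1 ≤ q := by exact_mod_cast Finset.mem_range.mp hk
    rw [Int.fract_eq_self]
    exact ⟨by positivity, by rw [div_lt_one hq']; linarith⟩
  have hgauss : ∑ k ∈ Finset.range q, (u + k) / (q : ℝ) - q / 2 = u - 1 / 2 := by
    have hg : (∑ k ∈ Finset.range q, (k : ℝ)) = q * (q - 1) / 2 := by
      have := Finset.sum_range_id_mul_two q
      have hcast : ((∑ k ∈ Finset.range q, k : ℕ) : ℝ) * 2 = q * (q - 1) := by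
        rw [← Nat.cast_pred hq]
        exact_mod_cast this
      push_cast at hcast
      linarith
    rw [← Finset.sum_div, Finset.sum_add_distrib, hg, Finset.sum_const, Finset.card_range,
      nsmul_eq_mul]
    field_simp
    ring
  have hrat : ∑ j ∈ Finset.range q, Int.fract (x + j * (p / q) : ℝ) - q / 2 = u - 1 / 2 := by
    rw [sum_range_rational_rotation hper hq hpq, Finset.sum_congr rfl hfr, hgauss]
  have hcount : ∀ (S : ℝ → Prop) [DecidablePred S] (k₀ : ℕ),
      (∀ k < q, S ((u + k) / q) → k = k₀) →
      ∑ j ∈ Finset.range q, (if S (Int.fract (x + j * (p / q))) then (1 : ℝ) else 0) ≤ 1 := by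
    intro S _ k₀ hS
    rw [sum_range_rational_rotation (ψ := fun y => if S (Int.fract y) then (1 : ℝ) else 0)
      (fun y => by simp only [Int.fract_add_one]) hq hpq]
    calc _ ≤ ∑ k ∈ Finset.range q, (if k = k₀ then (1 : ℝ) else 0) := by
          refine Finset.sum_le_sum fun k hk => ?_
          rw [hfr k hk]
          split_ifs with h1 h2
          · exact le_rfl
          · exact absurd (hS k (Finset.mem_range.mp hk) h1) h2
          · exact zero_le_one
          · exact le_rfl
      _ ≤ 1 := by
          rw [Finset.sum_ite_eq']
          split_ifs <;> norm_num
  have hlow := hcount (fun t => t < 1 / q) 0 fun k _ h => by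
    rw [div_lt_div_iff_of_pos_right hq'] at h
    have : (k : ℝ) < 1 := by linarith
    exact Nat.lt_one_iff.mp (by exact_mod_cast this)
  have hhigh := hcount (fun t => 1 - 1 / q ≤ t) (q - 1) fun k hk h => by
    rw [le_div_iff₀ hq', sub_mul, one_div_mul_cancel hq'.ne'] at h
    have : (q : ℝ) < k + 2 := by linarith
    have : q < k + 2 := by exact_mod_cast this
    omega
  have hdiff : |∑ j ∈ Finset.range q, Int.fract (x + j * α)
      - ∑ j ∈ Finset.range q, Int.fract (x + j * (p / q) : ℝ)| ≤ 3 := by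
    rw [← Finset.sum_sub_distrib]
    calc _ ≤ ∑ j ∈ Finset.range q, |Int.fract (x + j * α) - Int.fract (x + j * (p / q) : ℝ)| :=
          Finset.abs_sum_le_sum_abs _ _
      _ ≤ _ := Finset.sum_le_sum fun j hj => abs_fract_sub_fract_le
          (abs_orbit_sub_le hq hα (Finset.mem_range.mp hj) x).le
      _ ≤ 3 := by
          rw [Finset.sum_add_distrib, Finset.sum_add_distrib, Finset.sum_const, Finset.card_range,
            nsmul_eq_mul, mul_one_div_cancel hq'.ne']
          linarith
  rw [birkhoffRot, Finset.sum_sub_distrib, Finset.sum_const, Finset.card_range, nsmul_eq_mul]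
  rw [abs_le] at hdiff ⊢
  constructor <;> linarith

theorem abs_sinc_sub_sinc_le (x y : ℝ) : |Real.sinc x - Real.sinc y| ≤ |x - y| := by
  have hint : ∀ x : ℝ, Real.sinc x = ∫ t in (0 : ℝ)..1, Real.cos (x * t) := fun x => by
    rcases eq_or_ne x 0 with rfl | hx
    · simp
    · rw [intervalIntegral.integral_comp_mul_left _ hx, integral_cos, Real.sinc_of_ne_zero hx]
      simp [div_eq_inv_mul]
  have hcont : ∀ x : ℝ, IntervalIntegrable (fun t => Real.cos (x * t)) volume 0 1 := fun x =>
    (by fun_prop : Continuous fun t => Real.cos (x * t)).intervalIntegrable _ _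
  rw [hint, hint, ← intervalIntegral.integral_sub (hcont x) (hcont y)]
  have := intervalIntegral.norm_integral_le_of_norm_le_const (a := (0 : ℝ)) (b := 1)
    (C := |x - y|) (f := fun t => Real.cos (x * t) - Real.cos (y * t)) fun t ht => by
      rw [Set.uIoc_of_le zero_le_one] at ht
      calc ‖Real.cos (x * t) - Real.cos (y * t)‖ ≤ |x * t - y * t| :=
            Real.abs_cos_sub_cos_le _ _
        _ = |x - y| * t := by rw [← sub_mul, abs_mul, abs_of_pos ht.1]
        _ ≤ |x - y| := mul_le_of_le_one_right (abs_nonneg _) ht.2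
  simpa using this

theorem two_le_pi_mul_sinc_add_sinc {t : ℝ} (ht : t ∈ Set.Icc (0 : ℝ) 1) :
    2 ≤ Real.pi * (Real.sinc (Real.pi * t) + Real.sinc (Real.pi * (1 - t))) := by
  have hnonneg : ∀ s ∈ Set.Icc (0 : ℝ) 1, 0 ≤ Real.sinc (Real.pi * s) := fun s hs => by
    rw [Real.sinc_apply]
    split_ifs
    · exact zero_le_one
    · have := Real.pi_pos
      have h0 := hs.1
      have h1 := hs.2
      exact div_nonneg (Real.sin_nonneg_of_nonneg_of_le_pi (by positivity) (by nlinarith))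
        (by positivity)
  have hhalf : ∀ s ∈ Set.Icc (0 : ℝ) (1 / 2),
      2 ≤ Real.pi * Real.sinc (Real.pi * s) := fun s hs => by
    rcases hs.1.eq_or_lt with h0 | h0
    · rw [← h0, mul_zero, Real.sinc_zero, mul_one]
      exact Real.two_le_pi
    · have hpi := Real.pi_pos
      rw [Real.sinc_of_ne_zero (by positivity)]
      have := Real.mul_le_sin (x := Real.pi * s) (by positivity) (by nlinarith [hs.2])
      rw [show 2 / Real.pi * (Real.pi * s) = 2 * s by field_simp] at this
      rw [show Real.pi * (Real.sin (Real.pi * s) / (Real.pi * s)) = Real.sin (Real.pi * s) / s by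
        field_simp, le_div_iff₀ h0]
      exact this
  have hpi := Real.pi_pos
  rw [mul_add]
  rcases le_total t (1 / 2) with h | h
  · have h1 := hhalf t ⟨ht.1, h⟩
    have h2 := mul_nonneg hpi.le (hnonneg (1 - t) ⟨by linarith, by linarith [ht.1]⟩)
    linarith
  · have h1 := hhalf (1 - t) ⟨by linarith [ht.2], by linarith⟩
    have h2 := mul_nonneg hpi.le (hnonneg t ht)
    linarith

theorem abs_log_sub_log_le {a b : ℝ} (ha : 1 ≤ a) (hb : 1 ≤ b) :
    |Real.log a - Real.log b| ≤ |a - b| := by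
  have key : ∀ a b : ℝ, 1 ≤ a → 1 ≤ b → Real.log a - Real.log b ≤ |a - b| := fun a b ha hb => by
    have h0 : 0 < b := by linarith
    rw [← Real.log_div (by positivity) h0.ne']
    calc Real.log (a / b) ≤ a / b - 1 := Real.log_le_sub_one_of_pos (by positivity)
      _ = (a - b) / b := by field_simp
      _ ≤ |a - b| / b := by gcongr; exact le_abs_self _
      _ ≤ |a - b| := div_le_self (abs_nonneg _) hb
  rw [abs_le]
  have h1 := key a b ha hb
  have h2 := key b a hb ha
  rw [abs_sub_comm b a] at h2
  constructor <;> linarith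

/-- A periodic function that is Lipschitz on a period is Lipschitz. -/
theorem abs_sub_le_of_periodic {h : ℝ → ℝ} (hper : Function.Periodic h 1) {M : ℝ}
    (hlip : ∀ x ∈ Set.Icc (0 : ℝ) 1, ∀ y ∈ Set.Icc (0 : ℝ) 1, |h x - h y| ≤ M * |x - y|)
    (x y : ℝ) : |h x - h y| ≤ M * |x - y| := by
  have hcell : ∀ (n : ℤ) (x y : ℝ), x ∈ Set.Icc (n : ℝ) (n + 1) → y ∈ Set.Icc (n : ℝ) (n + 1) →
      |h x - h y| ≤ M * |x - y| := fun n x y hx hy => by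
    have := hlip (x - n) ⟨by linarith [hx.1], by linarith [hx.2]⟩ (y - n)
      ⟨by linarith [hy.1], by linarith [hy.2]⟩
    have hn : ∀ z, h (z - n) = h z := fun z => by simpa using hper.sub_int_mul_eq n (x := z)
    rwa [hn, hn, sub_sub_sub_cancel_right] at this
  have hM : 0 ≤ M := by
    have := (abs_nonneg _).trans (hlip 0 (by simp) 1 (by simp))
    simpa using this
  wlog hxy : x ≤ y generalizing x y
  · rw [abs_sub_comm, abs_sub_comm x]
    exact this y x (le_of_not_ge hxy)
  have hx := Int.floor_le x
  have hx' := Int.lt_floor_add_one x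
  have hy := Int.floor_le y
  have hy' := Int.lt_floor_add_one y
  rcases (Int.floor_mono hxy).eq_or_lt with heq | hlt
  · rw [heq] at hx hx'
    exact hcell ⌊y⌋ x y ⟨hx, hx'.le⟩ ⟨hy, hy'.le⟩
  · have hle : (⌊x⌋ : ℝ) + 1 ≤ ⌊y⌋ := by exact_mod_cast hlt
    have hends : h (⌊x⌋ + 1) = h ⌊y⌋ := by
      have hint : ∀ n : ℤ, h n = h 0 := fun n => by simpa using hper.int_mul n 0
      exact_mod_cast (hint (⌊x⌋ + 1)).trans (hint ⌊y⌋).symm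
    have h1 := hcell ⌊x⌋ x (⌊x⌋ + 1) ⟨hx, hx'.le⟩ ⟨by linarith, le_rfl⟩
    have h2 := hcell ⌊y⌋ ⌊y⌋ y ⟨le_rfl, by linarith⟩ ⟨hy, hy'.le⟩
    rw [abs_of_nonpos (by linarith : x - (⌊x⌋ + 1) ≤ 0)] at h1
    rw [abs_of_nonpos (by linarith : ⌊y⌋ - y ≤ 0)] at h2
    rw [abs_of_nonpos (by linarith : x - y ≤ 0)]
    rw [hends] at h1
    have := abs_sub_le (h x) (h ⌊y⌋) (h y)
    nlinarith

/-- The Lipschitz difference between `symLog` and `-log (2 sin (π x))`. -/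
def logSinc (x : ℝ) : ℝ :=
  Real.log (2 * (Real.pi * (Real.sinc (Real.pi * Int.fract x)
    + Real.sinc (Real.pi * (1 - Int.fract x)))))

theorem logSinc_periodic : Function.Periodic logSinc 1 := fun x => by
  simp only [logSinc, Int.fract_add_one]

theorem abs_logSinc_sub_le (x y : ℝ) :
    |logSinc x - logSinc y| ≤ 4 * Real.pi ^ 2 * |x - y| := by
  refine abs_sub_le_of_periodic logSinc_periodic (fun x hx y hy => ?_) x y
  have hrep : ∀ z ∈ Set.Icc (0 : ℝ) 1, logSinc z = Real.log (2 * (Real.pi *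
      (Real.sinc (Real.pi * z) + Real.sinc (Real.pi * (1 - z))))) := fun z hz => by
    rcases hz.2.eq_or_lt with rfl | h1
    · simp [logSinc, add_comm]
    · rw [logSinc, Int.fract_eq_self.mpr ⟨hz.1, h1⟩]
  have hpi := Real.pi_pos
  rw [hrep x hx, hrep y hy]
  have h1 := abs_sinc_sub_sinc_le (Real.pi * x) (Real.pi * y)
  have h2 := abs_sinc_sub_sinc_le (Real.pi * (1 - x)) (Real.pi * (1 - y))
  rw [← mul_sub, abs_mul, abs_of_pos hpi] at h1 h2
  rw [show (1 - x) - (1 - y) = -(x - y) by ring, abs_neg] at h2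
  refine (abs_log_sub_log_le (by linarith [two_le_pi_mul_sinc_add_sinc hx])
    (by linarith [two_le_pi_mul_sinc_add_sinc hy])).trans ?_
  rw [← mul_sub, ← mul_sub, abs_mul, abs_mul, abs_of_pos hpi, abs_of_pos (zero_lt_two' ℝ),
    add_sub_add_comm]
  calc _ ≤ 2 * (Real.pi * (Real.pi * |x - y| + Real.pi * |x - y|)) := by
        gcongr
        exact (abs_add_le _ _).trans (add_le_add h1 h2)
    _ = _ := by ring

theorem symLog_eq {x : ℝ} (hx : Int.fract x ≠ 0) :
    symLog x = logSinc x - Real.log (2 * Real.sin (Real.pi * Int.fract x)) := by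
  have h0 : 0 < Int.fract x := lt_of_le_of_ne (Int.fract_nonneg x) hx.symm
  have h1 : 0 < 1 - Int.fract x := sub_pos.mpr (Int.fract_lt_one x)
  rw [symLog, logSinc]
  generalize Int.fract x = t at h0 h1
  have hpi := Real.pi_pos
  have hsin : 0 < Real.sin (Real.pi * t) :=
    Real.sin_pos_of_pos_of_lt_pi (by positivity) (by nlinarith)
  rw [Real.sinc_of_ne_zero (by positivity), Real.sinc_of_ne_zero (by positivity),
    show Real.pi * (1 - t) = Real.pi - Real.pi * t by ring, Real.sin_pi_sub,
    show 2 * (Real.pi * (Real.sin (Real.pi * t) / (Real.pi * t)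
      + Real.sin (Real.pi * t) / (Real.pi - Real.pi * t)))
      = 2 * Real.sin (Real.pi * t) / (t * (1 - t)) by
        rw [show Real.pi - Real.pi * t = Real.pi * (1 - t) by ring]
        field_simp
        ring,
    Real.log_div (by positivity) (by positivity), Real.log_mul h0.ne' h1.ne']
  ring

/-- The point `exp (2 π i x)` of the unit circle. -/
def circlePoint (x : ℝ) : ℂ := Complex.exp ((2 * Real.pi * x : ℝ) * Complex.I)

theorem norm_circlePoint (x : ℝ) : ‖circlePoint x‖ = 1 := Complex.norm_exp_ofReal_mul_I _

theorem continuous_circlePoint : Continuous circlePoint := by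
  unfold circlePoint
  fun_prop

theorem circlePoint_add (x y : ℝ) : circlePoint (x + y) = circlePoint x * circlePoint y := by
  rw [circlePoint, circlePoint, circlePoint, ← Complex.exp_add]
  congr 1
  push_cast
  ring

theorem circlePoint_fract (x : ℝ) : circlePoint (Int.fract x) = circlePoint x := by
  rw [circlePoint, circlePoint, ← Int.self_sub_floor,
    ← Complex.exp_periodic.sub_int_mul_eq (x := ((2 * Real.pi * x : ℝ) * Complex.I)) ⌊x⌋]
  congr 1
  push_cast
  ring

theorem exists_circlePoint_eq {z : ℂ} (hz : ‖z‖ = 1) : ∃ x, circlePoint x = z := by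
  refine ⟨Complex.arg z / (2 * Real.pi), ?_⟩
  have := Complex.norm_mul_exp_arg_mul_I z
  rw [hz, Complex.ofReal_one, one_mul] at this
  rw [circlePoint, mul_div_cancel₀ _ Real.two_pi_pos.ne', this]

theorem one_sub_circlePoint (t : ℝ) :
    1 - circlePoint t = (2 * Real.sin (Real.pi * t) : ℝ) *
      Complex.exp ((Real.pi * (t - 1 / 2) : ℝ) * Complex.I) := by
  rw [circlePoint, Complex.exp_mul_I, Complex.exp_mul_I, ← Complex.ofReal_cos,
    ← Complex.ofReal_sin, ← Complex.ofReal_cos, ← Complex.ofReal_sin,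
    show 2 * Real.pi * t = 2 * (Real.pi * t) by ring,
    show Real.pi * (t - 1 / 2) = Real.pi * t - Real.pi / 2 by ring,
    Real.cos_sub_pi_div_two, Real.sin_sub_pi_div_two, Real.cos_two_mul, Real.sin_two_mul]
  have h := Real.sin_sq_add_cos_sq (Real.pi * t)
  apply Complex.ext
  · simp only [Complex.sub_re, Complex.one_re, Complex.add_re, Complex.mul_re, Complex.ofReal_re,
      Complex.ofReal_im, Complex.I_re, Complex.I_im, Complex.add_im, Complex.mul_im]
    linear_combination -2 * h
  · simp only [Complex.sub_im, Complex.one_im, Complex.add_re, Complex.mul_re, Complex.ofReal_re,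
      Complex.ofReal_im, Complex.I_re, Complex.I_im, Complex.add_im, Complex.mul_im]
    ring

theorem one_sub_circlePoint_cpow (y : ℝ) {η : ℝ} (hη : 0 < η) :
    (1 - circlePoint y) ^ (η : ℂ) = ((2 * Real.sin (Real.pi * Int.fract y)) ^ η : ℝ) *
      Complex.exp ((η * Real.pi * (Int.fract y - 1 / 2) : ℝ) * Complex.I) := by
  rw [← circlePoint_fract, one_sub_circlePoint]
  have h0 := Int.fract_nonneg y
  have h1 := Int.fract_lt_one y
  generalize Int.fract y = t at h0 h1
  have hpi := Real.pi_pos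
  rcases h0.eq_or_lt with rfl | h0
  · simp [Real.zero_rpow hη.ne', hη.ne']
  · have hsin : 0 < 2 * Real.sin (Real.pi * t) :=
      mul_pos two_pos (Real.sin_pos_of_pos_of_lt_pi (by positivity) (by nlinarith))
    rw [Complex.cpow_def_of_ne_zero
        (mul_ne_zero (Complex.ofReal_ne_zero.mpr hsin.ne') (Complex.exp_ne_zero _)),
      Complex.log_ofReal_mul hsin (Complex.exp_ne_zero _), Complex.log_exp
        (by simp only [Complex.mul_im, Complex.ofReal_re, Complex.I_im, Complex.ofReal_im,
              Complex.I_re]; nlinarith)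
        (by simp only [Complex.mul_im, Complex.ofReal_re, Complex.I_im, Complex.ofReal_im,
              Complex.I_re]; nlinarith),
      Real.rpow_def_of_pos hsin, Complex.ofReal_exp, ← Complex.exp_add]
    congr 1
    push_cast
    ring

/-- The product `∏ (1 - z exp (2 π i θ_j)) ^ (1/12)`, analytic in the unit disc. -/
def rotProd (θ : ℕ → ℝ) (q : ℕ) (z : ℂ) : ℂ :=
  ∏ j ∈ Finset.range q, (1 - z * circlePoint (θ j)) ^ ((1 / 12 : ℝ) : ℂ)

theorem rotProd_zero (θ : ℕ → ℝ) (q : ℕ) : rotProd θ q 0 = 1 := by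
  simp [rotProd]

theorem diffContOnCl_rotProd (θ : ℕ → ℝ) (q : ℕ) :
    DiffContOnCl ℂ (rotProd θ q) (Metric.ball 0 1) := by
  have hre : ∀ (z : ℂ) (j : ℕ), (z * circlePoint (θ j)).re ≤ ‖z‖ := fun z j => by
    refine (Complex.re_le_norm _).trans ?_
    rw [norm_mul, norm_circlePoint, mul_one]
  constructor
  · refine DifferentiableOn.fun_finsetProd fun j _ => ?_
    refine DifferentiableOn.cpow_const (by fun_prop) fun z hz => Or.inl ?_
    rw [mem_ball_zero_iff] at hz
    rw [Complex.sub_re, Complex.one_re]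
    linarith [hre z j]
  · rw [closure_ball _ one_ne_zero]
    refine continuousOn_finsetProd _ fun j _ z hz => ContinuousAt.continuousWithinAt ?_
    rw [mem_closedBall_zero_iff] at hz
    refine ContinuousAt.comp (f := fun z => 1 - z * circlePoint (θ j))
      (Complex.continuousAt_cpow_const_of_re_pos (Or.inl ?_) ?_) (by fun_prop)
    · rw [Complex.sub_re, Complex.one_re]
      linarith [hre z j]
    · rw [Complex.ofReal_re]
      norm_num

/-- The modulus of `rotProd` on the unit circle. -/
def rotProdNorm (θ : ℕ → ℝ) (q : ℕ) (x : ℝ) : ℝ :=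
  ∏ j ∈ Finset.range q, (2 * Real.sin (Real.pi * Int.fract (x + θ j))) ^ (1 / 12 : ℝ)

theorem two_sin_pi_fract_nonneg (y : ℝ) : 0 ≤ 2 * Real.sin (Real.pi * Int.fract y) :=
  mul_nonneg zero_le_two (Real.sin_nonneg_of_nonneg_of_le_pi
    (mul_nonneg Real.pi_pos.le (Int.fract_nonneg y))
    (mul_le_of_le_one_right Real.pi_pos.le (Int.fract_lt_one y).le))

theorem rotProdNorm_nonneg (θ : ℕ → ℝ) (q : ℕ) (x : ℝ) : 0 ≤ rotProdNorm θ q x :=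
  Finset.prod_nonneg fun _ _ => Real.rpow_nonneg (two_sin_pi_fract_nonneg _) _

theorem rotProd_circlePoint (θ : ℕ → ℝ) (q : ℕ) (x : ℝ) :
    rotProd θ q (circlePoint x) = rotProdNorm θ q x * Complex.exp ((1 / 12 * Real.pi *
      ∑ j ∈ Finset.range q, (Int.fract (x + θ j) - 1 / 2) : ℝ) * Complex.I) := by
  rw [rotProd, rotProdNorm, Finset.mul_sum, Complex.ofReal_sum, Finset.sum_mul, Complex.exp_sum,
    Complex.ofReal_prod, ← Finset.prod_mul_distrib]
  refine Finset.prod_congr rfl fun j _ => ?_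
  rw [← circlePoint_add, one_sub_circlePoint_cpow _ (by norm_num)]

theorem norm_rotProd_circlePoint (θ : ℕ → ℝ) (q : ℕ) (x : ℝ) :
    ‖rotProd θ q (circlePoint x)‖ = rotProdNorm θ q x := by
  rw [rotProd_circlePoint, norm_mul, Complex.norm_exp_ofReal_mul_I, mul_one,
    Complex.norm_of_nonneg (rotProdNorm_nonneg θ q x)]

theorem half_rotProdNorm_le_re {θ : ℕ → ℝ} {q : ℕ} {x : ℝ}
    (h : |∑ j ∈ Finset.range q, (Int.fract (x + θ j) - 1 / 2)| ≤ 4) :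
    rotProdNorm θ q x / 2 ≤ (rotProd θ q (circlePoint x)).re := by
  rw [rotProd_circlePoint, Complex.re_ofReal_mul, Complex.exp_ofReal_mul_I_re, div_eq_mul_one_div]
  refine mul_le_mul_of_nonneg_left ?_ (rotProdNorm_nonneg θ q x)
  rw [← Real.cos_abs (_ * _)]
  have hpi := Real.pi_pos
  refine Real.cos_pi_div_three.symm.trans_le <|
    Real.cos_le_cos_of_nonneg_of_le_pi (abs_nonneg _) (by linarith) ?_
  rw [abs_mul, abs_of_pos (by positivity)]
  nlinarith

theorem rotProd_re_nonneg {θ : ℕ → ℝ} {q : ℕ}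
    (h : ∀ x, |∑ j ∈ Finset.range q, (Int.fract (x + θ j) - 1 / 2)| ≤ 4) {z : ℂ}
    (hz : z ∈ Metric.closedBall (0 : ℂ) 1) : 0 ≤ (rotProd θ q z).re := by
  have hd : DiffContOnCl ℂ (fun z => Complex.exp (-rotProd θ q z)) (Metric.ball 0 1) :=
    Complex.differentiable_exp.comp_diffContOnCl (diffContOnCl_rotProd θ q).neg
  have := Complex.norm_le_of_forall_mem_frontier_norm_le Metric.isBounded_ball hd (C := 1)
    (fun w hw => by
      rw [frontier_ball _ one_ne_zero, mem_sphere_zero_iff_norm] at hw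
      obtain ⟨x, rfl⟩ := exists_circlePoint_eq hw
      rw [Complex.norm_exp, Real.exp_le_one_iff, Complex.neg_re]
      linarith [half_rotProdNorm_le_re (h x), rotProdNorm_nonneg θ q x])
    (by rwa [closure_ball _ one_ne_zero])
  rw [Complex.norm_exp, Real.exp_le_one_iff, Complex.neg_re] at this
  linarith

/-- Lebesgue measure on `[0, 1)`. -/
abbrev unitLeb : Measure ℝ := (volume : Measure ℝ).restrict (Set.Ico (0 : ℝ) 1)

instance : IsProbabilityMeasure unitLeb := ⟨by simp⟩

theorem integral_circlePoint {F : ℂ → ℂ} (hF : DiffContOnCl ℂ F (Metric.ball 0 1)) :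
    ∫ x in (0 : ℝ)..1, F (circlePoint x) = F 0 := by
  have h := DiffContOnCl.circleAverage (f := F) (c := 0) (R := 1) (by rwa [abs_one])
  rw [← h, Real.circleAverage_def]
  have := intervalIntegral.integral_comp_mul_left (a := 0) (b := 1)
    (fun θ => F (circleMap 0 1 θ)) Real.two_pi_pos.ne'
  rw [mul_zero, mul_one] at this
  rw [← this]
  refine intervalIntegral.integral_congr fun x _ => ?_
  simp [circlePoint, circleMap]

theorem measureReal_le_re {F : ℂ → ℂ} (hF : DiffContOnCl ℂ F (Metric.ball 0 1))
    (hre : ∀ x, 0 ≤ (F (circlePoint x)).re) {m : ℝ} (hm : 0 < m) :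
    unitLeb.real {x | m ≤ (F (circlePoint x)).re} ≤ (F 0).re / m := by
  have hcont : Continuous fun x => F (circlePoint x) := by
    have := hF.2
    rw [closure_ball _ one_ne_zero] at this
    exact this.comp_continuous continuous_circlePoint fun x => by
      rw [mem_closedBall_zero_iff, norm_circlePoint]
  have hcre : Continuous fun x => (F (circlePoint x)).re := Complex.continuous_re.comp hcont
  have hint : Integrable (fun x => (F (circlePoint x)).re) unitLeb :=
    (hcre.integrableOn_Icc (a := 0) (b := 1)).mono_set Set.Ico_subset_Icc_self
  have hval : ∫ x, (F (circlePoint x)).re ∂unitLeb = (F 0).re := by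
    rw [integral_Ico_eq_integral_Ioc, ← intervalIntegral.integral_of_le zero_le_one,
      ← integral_circlePoint hF]
    exact Complex.reCLM.intervalIntegral_comp_comm (hcont.intervalIntegrable 0 1)
  rw [le_div_iff₀ hm, mul_comm, ← hval]
  exact mul_meas_ge_le_integral_of_nonneg (ae_of_all _ hre) hint m

theorem measureReal_le_rotProdNorm {θ : ℕ → ℝ} {q : ℕ}
    (h : ∀ x, |∑ j ∈ Finset.range q, (Int.fract (x + θ j) - 1 / 2)| ≤ 4) {m : ℝ} (hm : 0 < m) :
    unitLeb.real {x | m ≤ rotProdNorm θ q x} ≤ 2 / m := by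
  have := measureReal_le_re (diffContOnCl_rotProd θ q)
    (fun x => rotProd_re_nonneg h (by rw [mem_closedBall_zero_iff, norm_circlePoint]))
    (half_pos hm)
  rw [rotProd_zero, Complex.one_re, one_div_div] at this
  refine (measureReal_mono fun x hx => ?_).trans this
  have hx' : m ≤ rotProdNorm θ q x := hx
  exact (by linarith : m / 2 ≤ rotProdNorm θ q x / 2).trans (half_rotProdNorm_le_re (h x))

theorem measureReal_rotProdNorm_le {θ : ℕ → ℝ} {q : ℕ}
    (h : ∀ x, |∑ j ∈ Finset.range q, (Int.fract (x + θ j) - 1 / 2)| ≤ 4) {m : ℝ} (hm : 0 < m) :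
    unitLeb.real {x | rotProdNorm θ q x ≤ m} ≤ 4 * m := by
  have hne : ∀ z ∈ closure (Metric.ball (0 : ℂ) 1), rotProd θ q z + m ≠ 0 := fun z hz h0 => by
    rw [closure_ball _ one_ne_zero] at hz
    have h1 := rotProd_re_nonneg h hz
    have h2 := congrArg Complex.re h0
    rw [Complex.add_re, Complex.ofReal_re, Complex.zero_re] at h2
    linarith
  have hd : DiffContOnCl ℂ (fun z => (rotProd θ q z + m)⁻¹) (Metric.ball 0 1) :=
    ((diffContOnCl_rotProd θ q).add_const _).inv hne
  have hpos : ∀ x, 1 / (2 * (rotProdNorm θ q x + m)) ≤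
      (rotProd θ q (circlePoint x) + m)⁻¹.re := fun x => by
    have hR := rotProdNorm_nonneg θ q x
    have h1 := half_rotProdNorm_le_re (h x)
    have h2 : ‖rotProd θ q (circlePoint x) + m‖ ≤ rotProdNorm θ q x + m := by
      refine (norm_add_le _ _).trans_eq ?_
      rw [norm_rotProd_circlePoint, Complex.norm_of_nonneg hm.le]
    have h3 : 0 < ‖rotProd θ q (circlePoint x) + m‖ :=
      norm_pos_iff.mpr (hne _ (by
        rw [closure_ball _ one_ne_zero, mem_closedBall_zero_iff, norm_circlePoint]))
    rw [Complex.inv_re, Complex.normSq_eq_norm_sq, Complex.add_re, Complex.ofReal_re,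
      div_le_div_iff₀ (by positivity) (by positivity)]
    nlinarith
  have := measureReal_le_re hd (fun x => le_trans (by
    have := rotProdNorm_nonneg θ q x
    positivity) (hpos x)) (m := 1 / (4 * m)) (by positivity)
  rw [rotProd_zero, show (1 + (m : ℂ))⁻¹ = ((1 + m)⁻¹ : ℝ) by push_cast; rfl,
    Complex.ofReal_re] at this
  refine (measureReal_mono fun x hx => ?_).trans (this.trans ?_)
  · have hx' : rotProdNorm θ q x ≤ m := hx
    have hR := rotProdNorm_nonneg θ q x
    refine le_trans ?_ (hpos x)
    exact one_div_le_one_div_of_le (by positivity) (by linarith)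
  · rw [div_div_eq_mul_div, div_one]
    exact mul_le_of_le_one_left (by positivity) (inv_le_one_of_one_le₀ (by linarith))

theorem rotProdNorm_eq_exp {θ : ℕ → ℝ} {q : ℕ} {x : ℝ}
    (hx : ∀ j < q, Int.fract (x + θ j) ≠ 0) :
    rotProdNorm θ q x = Real.exp (1 / 12 * ∑ j ∈ Finset.range q,
      Real.log (2 * Real.sin (Real.pi * Int.fract (x + θ j)))) := by
  rw [rotProdNorm, Finset.mul_sum, Real.exp_sum]
  refine Finset.prod_congr rfl fun j hj => ?_
  have h0 := (Int.fract_nonneg (x + θ j)).lt_of_ne' (hx j (Finset.mem_range.mp hj))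
  have h1 := Int.fract_lt_one (x + θ j)
  have hpi := Real.pi_pos
  rw [Real.rpow_def_of_pos (mul_pos two_pos
    (Real.sin_pos_of_pos_of_lt_pi (by positivity) (by nlinarith))), mul_comm]

theorem ae_fract_ne_zero (θ : ℕ → ℝ) : ∀ᵐ x ∂unitLeb, ∀ j, Int.fract (x + θ j) ≠ 0 := by
  refine ae_restrict_of_ae (ae_all_iff.mpr fun j => ?_)
  have : (Set.range fun n : ℤ => (n : ℝ) - θ j).Countable := Set.countable_range _
  filter_upwards [this.ae_notMem volume] with x hx h0
  refine hx ⟨⌊x + θ j⌋, ?_⟩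
  have := Int.floor_add_fract (x + θ j)
  simp only
  linarith

/-- Exponential tails for sums of `log |2 sin|` along points whose sawtooth sums are bounded. -/
theorem measureReal_log_sin_sum_le {θ : ℕ → ℝ} {q : ℕ}
    (h : ∀ x, |∑ j ∈ Finset.range q, (Int.fract (x + θ j) - 1 / 2)| ≤ 4) (s : ℝ) :
    unitLeb.real {x | s ≤ |∑ j ∈ Finset.range q,
      Real.log (2 * Real.sin (Real.pi * Int.fract (x + θ j)))|} ≤
      6 * Real.exp (-(1 / 12) * s) := by
  have h1 := measureReal_le_rotProdNorm h (Real.exp_pos (1 / 12 * s))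
  have h2 := measureReal_rotProdNorm_le h (Real.exp_pos (-(1 / 12) * s))
  have h3 : 2 / Real.exp (1 / 12 * s) = 2 * Real.exp (-(1 / 12) * s) := by
    rw [neg_mul, Real.exp_neg, div_eq_mul_inv]
  rw [h3] at h1
  have hle : unitLeb {x | s ≤ |∑ j ∈ Finset.range q,
      Real.log (2 * Real.sin (Real.pi * Int.fract (x + θ j)))|} ≤
      unitLeb ({x | Real.exp (1 / 12 * s) ≤ rotProdNorm θ q x} ∪
        {x | rotProdNorm θ q x ≤ Real.exp (-(1 / 12) * s)}) := by
    refine measure_mono_ae ?_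
    filter_upwards [ae_fract_ne_zero θ] with x hx hs
    have hs' : s ≤ |_| := hs
    change Real.exp (1 / 12 * s) ≤ rotProdNorm θ q x ∨ rotProdNorm θ q x ≤ _
    rw [rotProdNorm_eq_exp fun j _ => hx j, Real.exp_le_exp, Real.exp_le_exp]
    rcases le_abs.mp hs' with hs' | hs'
    · left; linarith
    · right; linarith
  have hle' := ENNReal.toReal_mono (measure_ne_top _ _) hle
  refine hle'.trans ((measureReal_union_le _ _).trans ?_)
  linarith

theorem measurable_birkhoffRot_symLogRoof (α : ℝ) {g : ℝ → ℝ} (hg : Measurable g) (n : ℕ) :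
    Measurable (birkhoffRot α (symLogRoof g) n) := by
  have hsym : Measurable symLog := by
    unfold symLog
    exact (Real.measurable_log.comp measurable_fract).neg.sub
      (Real.measurable_log.comp (measurable_const.sub measurable_fract))
  have hroof : Measurable (symLogRoof g) := hsym.add hg
  unfold birkhoffRot
  exact Finset.measurable_fun_sum _ fun i _ => hroof.comp (measurable_id.add_const _)

theorem birkhoffRot_mul (α : ℝ) (f : ℝ → ℝ) (K q : ℕ) (x : ℝ) :
    birkhoffRot α f (K * q) x = ∑ i ∈ Finset.range K, birkhoffRot α f q (x + i * (q * α)) := by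
  induction K with
  | zero => simp [birkhoffRot]
  | succ K ih =>
    rw [Finset.sum_range_succ, ← ih, birkhoffRot, birkhoffRot, birkhoffRot, add_one_mul,
      Finset.sum_range_add]
    congr 1
    refine Finset.sum_congr rfl fun j _ => ?_
    congr 1
    push_cast
    ring

theorem exists_lipschitz_of_contDiff_periodic {g : ℝ → ℝ} (hper : Function.Periodic g 1)
    (hg : ContDiff ℝ 1 g) : ∃ M, 0 ≤ M ∧ ∀ x y, |g x - g y| ≤ M * |x - y| := by
  obtain ⟨M, hM⟩ := hg.contDiffOn.exists_lipschitzOnWith one_ne_zero (convex_Icc (0 : ℝ) 1)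
    isCompact_Icc
  refine ⟨M, M.2, abs_sub_le_of_periodic hper fun x hx y hy => ?_⟩
  simpa [Real.dist_eq] using hM.dist_le_mul x hx y hy

/-- Exponential tails for the Birkhoff sums at a convergent denominator, along any translate. -/
theorem measureReal_birkhoffRot_sub_le {α : ℝ} {p : ℤ} {q : ℕ} (hq : 0 < q)
    (hpq : IsCoprime p (q : ℤ)) (hα : |α - p / q| < 1 / (q : ℝ) ^ 2) {g : ℝ → ℝ} {M : ℝ}
    (hper : Function.Periodic g 1) (hM : 0 ≤ M) (hlip : ∀ x y, |g x - g y| ≤ M * |x - y|)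
    (y s : ℝ) :
    unitLeb.real {x | s ≤ |birkhoffRot α (symLogRoof g) q (x + y)
      - ∑ k ∈ Finset.range q, (logSinc (k / q) + g (k / q))|} ≤
      6 * Real.exp (1 / 6 * (4 * Real.pi ^ 2 + M)) * Real.exp (-(1 / 12) * s) := by
  set θ : ℕ → ℝ := fun j => y + j * α with hθ
  have hsaw : ∀ x, |∑ j ∈ Finset.range q, (Int.fract (x + θ j) - 1 / 2)| ≤ 4 := fun x => by
    have := abs_birkhoffRot_sawtooth_le hq hpq hα (x + y)
    simpa only [birkhoffRot, add_assoc] using this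
  have hDK := abs_birkhoffRot_sub_le_of_lipschitz hq hpq hα (h := fun x => logSinc x + g x)
    (M := 4 * Real.pi ^ 2 + M) (fun x => by simp only [logSinc_periodic x, hper x])
    (by positivity) (fun x z => by
      rw [add_sub_add_comm, add_mul]
      exact (abs_add_le _ _).trans (add_le_add (abs_logSinc_sub_le x z) (hlip x z)))
  have hle : unitLeb {x | s ≤ |birkhoffRot α (symLogRoof g) q (x + y)
      - ∑ k ∈ Finset.range q, (logSinc (k / q) + g (k / q))|} ≤
      unitLeb {x | s - 2 * (4 * Real.pi ^ 2 + M) ≤ |∑ j ∈ Finset.range q,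
        Real.log (2 * Real.sin (Real.pi * Int.fract (x + θ j)))|} := by
    refine measure_mono_ae ?_
    filter_upwards [ae_fract_ne_zero θ] with x hx hs
    have hs' : s ≤ |_| := hs
    change _ ≤ |_|
    have hsplit : birkhoffRot α (symLogRoof g) q (x + y) =
        birkhoffRot α (fun x => logSinc x + g x) q (x + y) - ∑ j ∈ Finset.range q,
          Real.log (2 * Real.sin (Real.pi * Int.fract (x + θ j))) := by
      rw [birkhoffRot, birkhoffRot, ← Finset.sum_sub_distrib]
      refine Finset.sum_congr rfl fun j _ => ?_
      rw [add_assoc, symLogRoof, symLog_eq (hx j)]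
      ring
    rw [hsplit, sub_right_comm] at hs'
    have h1 := hDK (x + y)
    have h2 := abs_sub (birkhoffRot α (fun x => logSinc x + g x) q (x + y) -
      ∑ k ∈ Finset.range q, (logSinc (k / q) + g (k / q)))
      (∑ j ∈ Finset.range q, Real.log (2 * Real.sin (Real.pi * Int.fract (x + θ j))))
    linarith
  refine (ENNReal.toReal_mono (measure_ne_top _ _) hle).trans
    ((measureReal_log_sin_sum_le hsaw _).trans_eq ?_)
  rw [mul_assoc, ← Real.exp_add]
  congr 2
  ring

theorem measureReal_birkhoffRot_mul_sub_le {α : ℝ} {p : ℤ} {q : ℕ} (hq : 0 < q)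
    (hpq : IsCoprime p (q : ℤ)) (hα : |α - p / q| < 1 / (q : ℝ) ^ 2) {g : ℝ → ℝ} {M : ℝ}
    (hper : Function.Periodic g 1) (hM : 0 ≤ M) (hlip : ∀ x y, |g x - g y| ≤ M * |x - y|)
    (K : ℕ) (s : ℝ) :
    unitLeb.real {x | s ≤ |birkhoffRot α (symLogRoof g) (K * q) x
      - K * ∑ k ∈ Finset.range q, (logSinc (k / q) + g (k / q))|} ≤
      (K + 1) * (6 * Real.exp (1 / 6 * (4 * Real.pi ^ 2 + M))) *
        Real.exp (-(1 / (12 * (K + 1))) * s) := by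
  set A := 6 * Real.exp (1 / 6 * (4 * Real.pi ^ 2 + M)) with hA
  set D := ∑ k ∈ Finset.range q, (logSinc (k / q) + g (k / q))
  have hA1 : 1 ≤ A := by
    have : 1 ≤ Real.exp (1 / 6 * (4 * Real.pi ^ 2 + M)) := Real.one_le_exp (by positivity)
    linarith
  have hK : (0 : ℝ) < K + 1 := by positivity
  rcases le_or_gt s 0 with hs | hs
  · refine measureReal_le_one.trans ?_
    have h1 : 1 ≤ Real.exp (-(1 / (12 * (K + 1))) * s) := Real.one_le_exp
      (mul_nonneg_of_nonpos_of_nonpos (neg_nonpos.mpr (by positivity)) hs)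
    have h2 : (1 : ℝ) ≤ K + 1 := le_add_of_nonneg_left (Nat.cast_nonneg K)
    exact one_le_mul_of_one_le_of_one_le (one_le_mul_of_one_le_of_one_le h2 hA1) h1
  have hsub : {x | s ≤ |birkhoffRot α (symLogRoof g) (K * q) x - K * D|} ⊆
      ⋃ i ∈ Finset.range K, {x | s / (K + 1) ≤
        |birkhoffRot α (symLogRoof g) q (x + i * (q * α)) - D|} := fun x hx => by
    by_contra hnot
    simp only [Set.mem_iUnion, Set.mem_ofPred_eq, not_exists, not_le] at hnot hx
    have hsum : birkhoffRot α (symLogRoof g) (K * q) x - K * D = ∑ i ∈ Finset.range K,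
        (birkhoffRot α (symLogRoof g) q (x + i * (q * α)) - D) := by
      rw [birkhoffRot_mul, Finset.sum_sub_distrib, Finset.sum_const, Finset.card_range,
        nsmul_eq_mul]
    have hlt : s ≤ K * (s / (K + 1)) := calc
      s ≤ _ := hx
      _ ≤ _ := by rw [hsum]; exact Finset.abs_sum_le_sum_abs _ _
      _ ≤ ∑ i ∈ Finset.range K, s / (K + 1) := Finset.sum_le_sum fun i hi => (hnot i hi).le
      _ = _ := by rw [Finset.sum_const, Finset.card_range, nsmul_eq_mul]
    have heq : K * (s / (K + 1)) = s - s / (K + 1) := by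
      field_simp
      ring
    have : 0 < s / (K + 1) := by positivity
    linarith
  calc _ ≤ _ := measureReal_mono hsub (measure_ne_top _ _)
    _ ≤ ∑ i ∈ Finset.range K, unitLeb.real {x | s / (K + 1) ≤
        |birkhoffRot α (symLogRoof g) q (x + i * (q * α)) - D|} :=
      measureReal_biUnion_finset_le _ _
    _ ≤ ∑ i ∈ Finset.range K, A * Real.exp (-(1 / 12) * (s / (K + 1))) :=
      Finset.sum_le_sum fun i _ => measureReal_birkhoffRot_sub_le hq hpq hα hper hM hlip _ _
    _ = K * A * Real.exp (-(1 / (12 * (K + 1))) * s) := by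
      rw [Finset.sum_const, Finset.card_range, nsmul_eq_mul, ← mul_assoc,
        show -(1 / 12 : ℝ) * (s / (K + 1)) = -(1 / (12 * (K + 1))) * s by field_simp]
    _ ≤ _ := by
      gcongr
      linarith

/-- If uniformly exponentially tight random variables, recentred by arbitrary constants, converge
in law to a probability measure, then the limit has exponential tails. -/
theorem exists_exp_tail_of_tendsto {Y : ℕ → ℝ → ℝ} {b : ℕ → ℝ} (hY : ∀ j, Measurable (Y j))
    {C r : ℝ} (hC : 0 < C) (hr : 0 < r)
    (htail : ∀ j s, unitLeb.real {x | s ≤ |Y j x|} ≤ C * Real.exp (-r * s))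
    (P : Measure ℝ) [IsProbabilityMeasure P]
    (hconv : ∀ ψ : BoundedContinuousFunction ℝ ℝ, Tendsto
      (fun j => ∫ x, ψ x ∂(Measure.map (fun x => Y j x - b j) unitLeb)) atTop (𝓝 (∫ x, ψ x ∂P))) :
    ∃ C' > (0 : ℝ), ∃ r' > (0 : ℝ), ∀ s > (0 : ℝ),
      P {t : ℝ | s ≤ |t|} ≤ ENNReal.ofReal (C' * Real.exp (-r' * s)) := by
  have hX : ∀ j, Measurable fun x => Y j x - b j := fun j => (hY j).sub_const _
  let μ : ℕ → ProbabilityMeasure ℝ := fun j =>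
    ⟨Measure.map (fun x => Y j x - b j) unitLeb,
      Measure.isProbabilityMeasure_map (hX j).aemeasurable⟩
  have hμ : Tendsto μ atTop (𝓝 (⟨P, inferInstance⟩ : ProbabilityMeasure ℝ)) :=
    ProbabilityMeasure.tendsto_iff_forall_integral_tendsto.mpr hconv
  have hopen : ∀ G : Set ℝ, IsOpen G →
      P G ≤ liminf (fun j => unitLeb {x | Y j x - b j ∈ G}) atTop := fun G hG => by
    have := ProbabilityMeasure.le_liminf_measure_open_of_tendsto hμ hG
    refine this.trans_eq (liminf_congr (Eventually.of_forall fun j => ?_))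
    exact Measure.map_apply (hX j) hG.measurableSet
  have hball : ∃ n : ℕ, (1 / 4 : ENNReal) < P {t | |t| < n} := by
    have hmono : Monotone fun n : ℕ => {t : ℝ | |t| < n} := fun m n hmn t ht =>
      lt_of_lt_of_le (show |t| < m from ht) (by exact_mod_cast hmn)
    have hunion : ⋃ n : ℕ, {t : ℝ | |t| < n} = Set.univ :=
      Set.eq_univ_of_forall fun t => Set.mem_iUnion.mpr (exists_nat_gt |t|)
    have hlim := tendsto_measure_iUnion_atTop (μ := P) hmono
    rw [hunion, measure_univ] at hlim
    exact (hlim.eventually_const_lt (by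
      rw [one_div]
      exact ENNReal.inv_lt_one.mpr (by norm_num))).exists
  obtain ⟨n, hn⟩ := hball
  set R := Real.log (4 * C) / r
  have hR : C * Real.exp (-r * R) = 1 / 4 := by
    rw [show -r * R = -Real.log (4 * C) by simp only [R]; field_simp, Real.exp_neg,
      Real.exp_log (by positivity)]
    field_simp
  have hb : ∀ᶠ j in atTop, |b j| < n + R := by
    have hev := eventually_lt_of_lt_liminf
      (hn.trans_le (hopen _ (isOpen_lt continuous_abs continuous_const)))
    filter_upwards [hev] with j hj
    by_contra hbj
    rw [not_lt] at hbj
    have hsub : {x | Y j x - b j ∈ {t : ℝ | |t| < n}} ⊆ {x | R ≤ |Y j x|} := fun x hx => by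
      have hx' : |Y j x - b j| < n := hx
      have := abs_sub_abs_le_abs_sub (b j) (Y j x)
      rw [abs_sub_comm] at this
      exact (by linarith : R ≤ |Y j x|)
    have h1 := hj.trans_le (measure_mono hsub)
    have h2 := htail j R
    rw [hR] at h2
    rw [← ofReal_measureReal, show (1 / 4 : ENNReal) = ENNReal.ofReal (1 / 4) by
      rw [ENNReal.ofReal_div_of_pos (by norm_num)]; simp] at h1
    exact absurd (ENNReal.lt_ofReal_iff_toReal_lt (by simp) |>.mp h1) (by
      rw [ENNReal.toReal_ofReal (by norm_num)]; exact not_lt.mpr h2)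
  refine ⟨C * Real.exp (r * (1 + (n + R))), by positivity, r, hr, fun s _ => ?_⟩
  have hsub : {t : ℝ | s ≤ |t|} ⊆ {t | s - 1 < |t|} := fun t ht =>
    (sub_one_lt s).trans_le ht
  refine (measure_mono hsub).trans
    ((hopen _ (isOpen_lt continuous_const continuous_abs)).trans ?_)
  refine liminf_le_of_frequently_le' (Eventually.frequently ?_)
  filter_upwards [hb] with j hj
  have hsub' : {x | Y j x - b j ∈ {t : ℝ | s - 1 < |t|}} ⊆ {x | s - 1 - (n + R) ≤ |Y j x|} :=
    fun x hx => by
      have hx' : s - 1 < |Y j x - b j| := hx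
      have := abs_sub (Y j x) (b j)
      exact (by linarith : s - 1 - (n + R) ≤ |Y j x|)
  refine (measure_mono hsub').trans ?_
  rw [← ofReal_measureReal]
  refine ENNReal.ofReal_le_ofReal ((htail j _).trans_eq ?_)
  rw [mul_assoc, ← Real.exp_add]
  congr 2
  ring

/-- For `α ∈ 𝒞_{K,L}` (`L > K`) with associated sequence `(n_k)` and
`f(x) = -log x - log(1-x) + g(x)` (`g ∈ C³(𝕋)`, `g > 0`): if `P` is a probability measure
on `ℝ` which is the weak limit of a subsequence of the pushforwards
`(S_{K q_{n_k}}(f) - K c_k)_*(Leb)`, then `P` has exponential decay: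
`P({t : |t| ≥ s}) ≤ C̄ e^{-c̄ s}` for all `s > 0`, for some constants `C̄, c̄ > 0`. -/
theorem statement19 (K L : ℕ) (hKL : K < L)
    (α : ℝ) (hirr : Irrational α) (hα : α ∈ Set.Ioo (0 : ℝ) 1)
    (nk : ℕ → ℕ) (hnk : StrictMono nk) (c : ℝ) (hc : 0 < c)
    (hdio1 : ∀ k n : ℕ, 1 ≤ n → n ≤ nk k →
      (cfA α (nk k + 1 - n) : ℝ) ≤ Real.exp (c * n))
    (hdio2 : ∀ k : ℕ, 100 * (K ^ 2 + L ^ 2) < cfA α (nk k + 1) ∧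
      cfA α (nk k + 1) < 200 * (K ^ 2 + L ^ 2))
    (g : ℝ → ℝ) (hgper : Function.Periodic g 1) (hg : ContDiff ℝ 3 g) (hgpos : ∀ x, 0 < g x)
    (P : Measure ℝ) [IsProbabilityMeasure P]
    (φ : ℕ → ℕ) (hφ : StrictMono φ)
    (hconv : ∀ ψ : BoundedContinuousFunction ℝ ℝ,
      Tendsto (fun j => ∫ x, ψ x ∂(Measure.map
          (fun x => birkhoffRot α (symLogRoof g) (K * cfQ α (nk (φ j))) x
            - (K : ℝ) * birkhoffRot α (symLogRoof g) (cfQ α (nk (φ j)))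
                (1 / (2 * (cfQ α (nk (φ j)) : ℝ))))
          ((volume : Measure ℝ).restrict (Set.Ico (0 : ℝ) 1))))
        atTop (𝓝 (∫ x, ψ x ∂P))) :
    ∃ C > (0 : ℝ), ∃ c' > (0 : ℝ), ∀ s > (0 : ℝ),
      P {t : ℝ | s ≤ |t|} ≤ ENNReal.ofReal (C * Real.exp (-c' * s)) := by
  obtain ⟨M, hM, hlip⟩ := exists_lipschitz_of_contDiff_periodic hgper (hg.of_le (by norm_num))
  set q : ℕ → ℕ := fun j => cfQ α (nk (φ j))
  set D : ℕ → ℝ := fun j => ∑ k ∈ Finset.range (q j), (logSinc (k / q j) + g (k / q j))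
  refine exists_exp_tail_of_tendsto
    (Y := fun j x => birkhoffRot α (symLogRoof g) (K * q j) x - K * D j)
    (b := fun j => K * birkhoffRot α (symLogRoof g) (q j) (1 / (2 * (q j : ℝ))) - K * D j)
    (fun j => (measurable_birkhoffRot_symLogRoof α hg.continuous.measurable _).sub_const _)
    (by positivity) (by positivity) (fun j s => ?_) P (fun ψ => ?_)
    (C := (K + 1) * (6 * Real.exp (1 / 6 * (4 * Real.pi ^ 2 + M)))) (r := 1 / (12 * (K + 1)))
  · obtain ⟨p, hpq, hp⟩ := exists_isCoprime_abs_sub_le hirr hα (nk (φ j))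
    exact measureReal_birkhoffRot_mul_sub_le (one_le_cfQ hirr _) hpq hp hgper hM hlip K s
  · simpa only [sub_sub_sub_cancel_right] using hconv ψ
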